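/- Let T > 0, σ_Y > 0, γ° > 0, let α : [0,T] → ℝ be continuous, and let γ : [0,T] → ℝ be C¹ with γ(t) > 0 for all t, γ(0) = γ°, and γ'(t) = −α(t)²·γ(t)²/σ_Y² on [0,T]. Then for every t ∈ [0,T]: ∫₀ᵗ exp(−2·∫ₛᵗ α(u)²·γ(u)/σ_Y² du) · (α(s)²·γ(s)²/σ_Y²) ds = γ(t)·(1 − γ(t)/γ°). -/

import Mathlib

open Set

/-- The fundamental theorem of calculus on a subinterval `[a, b]` of `[0, T]`, for a function with
a continuous one-sided derivative. -/
lemma integral_eq_sub_of_hasDerivWithinAt_Icc {T a b : ℝ} {f f' : ℝ → ℝ}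
    (ha : 0 ≤ a) (hab : a ≤ b) (hb : b ≤ T)
    (hf : ∀ x ∈ Icc 0 T, HasDerivWithinAt f (f' x) (Icc 0 T) x)
    (hf' : ContinuousOn f' (Icc 0 T)) :
    ∫ x in a..b, f' x = f b - f a := by
  have hsub : Icc a b ⊆ Icc 0 T := Icc_subset_Icc ha hb
  refine intervalIntegral.integral_eq_sub_of_hasDerivAt_of_le hab
    (fun x hx => ((hf x (hsub hx)).continuousWithinAt.mono hsub)) (fun x hx => ?_) ?_
  · exact (hf x (hsub (Ioo_subset_Icc_self hx))).hasDerivAt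
      (Icc_mem_nhds (ha.trans_lt hx.1) (hx.2.trans_le hb))
  · exact (hf'.mono hsub).intervalIntegrable_of_Icc hab

/-- The long-run player's uncertainty about the myopic player's belief in the
no-feedback case: `∫₀ᵗ R(t,s)² α_s² γ_s²/σY² ds = γ_t (1 − γ_t/γ°)`, where
`R(t,s) = exp(−∫ₛᵗ α_u² γ_u/σY² du)`. -/
theorem stmt_13 (T σY γo : ℝ) (hT : 0 < T) (hσY : 0 < σY) (hγo : 0 < γo)
    (α γ : ℝ → ℝ)
    (hα : ContinuousOn α (Icc 0 T))
    (hγC1 : ContDiffOn ℝ 1 γ (Icc 0 T))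
    (hγpos : ∀ t ∈ Icc (0:ℝ) T, 0 < γ t)
    (hγ0 : γ 0 = γo)
    (hγode : ∀ t ∈ Icc (0:ℝ) T,
      HasDerivWithinAt γ (-(α t)^2 * (γ t)^2 / σY^2) (Icc 0 T) t) :
    ∀ t ∈ Icc (0:ℝ) T,
      (∫ s in (0:ℝ)..t,
        Real.exp (-2 * ∫ u in s..t, (α u)^2 * γ u / σY^2) *
          ((α s)^2 * (γ s)^2 / σY^2))
        = γ t * (1 - γ t / γo) := by
  have hγc : ContinuousOn γ (Icc 0 T) := hγC1.continuousOn
  have hlog : ∀ x ∈ Icc 0 T, HasDerivWithinAt (fun u => -Real.log (γ u))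
      ((α x)^2 * γ x / σY^2) (Icc 0 T) x := fun x hx => by
    have hx0 := (hγpos x hx).ne'
    exact ((hγode x hx).log hx0).neg.congr_deriv (by field_simp)
  have hinv : ∀ x ∈ Icc 0 T, HasDerivWithinAt (fun u => (γ u)⁻¹)
      ((α x)^2 / σY^2) (Icc 0 T) x := fun x hx => by
    have hx0 := (hγpos x hx).ne'
    exact ((hγode x hx).fun_inv hx0).congr_deriv (by field_simp)
  intro t ht
  have hγt := hγpos t ht
  have hintegrand : ∀ s ∈ uIcc 0 t,
      Real.exp (-2 * ∫ u in s..t, (α u)^2 * γ u / σY^2) * ((α s)^2 * (γ s)^2 / σY^2)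
        = (γ t)^2 * ((α s)^2 / σY^2) := by
    intro s hs
    rw [uIcc_of_le ht.1] at hs
    have hγs := hγpos s ⟨hs.1, hs.2.trans ht.2⟩
    rw [integral_eq_sub_of_hasDerivWithinAt_Icc hs.1 hs.2 ht.2 hlog
        (((hα.pow 2).mul hγc).div_const _),
      show -2 * (-Real.log (γ t) - -Real.log (γ s))
        = Real.log ((γ t / γ s) ^ 2) by
          rw [Real.log_pow, Real.log_div hγt.ne' hγs.ne']; push_cast; ring,
      Real.exp_log (by positivity)]
    field_simp
  rw [intervalIntegral.integral_congr hintegrand, intervalIntegral.integral_const_mul,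
    integral_eq_sub_of_hasDerivWithinAt_Icc le_rfl ht.1 ht.2 hinv ((hα.pow 2).div_const _), hγ0]
  field_simp
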